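/- Let P be an N=1 SUSY PVA with N=1 superconformal vector G of central charge c ∈ C. Suppose there exist G-primary elements J and a_i (i ∈ I) such that J is even, {J_Λ J} = −G − (λχ/3)c, {J_Λ a_i} = J_{(0|0)}a_i for all i, and the set {J, G} ∪ {a_i, J_{(0|0)}a_i : i ∈ I} freely generates P as a C[∂,D]-algebra. Then, setting D̃ := J_{(0|0)}, P is an N=2 SUSY PVA with N=2 superconformal vector J; moreover P is freely generated by {J} ∪ {a_i : i ∈ I} as a C[∂,D,D̃]-algebra, where all a_i are J-primary. -/

import Mathlib

noncomputable section

/-- The sign `(-1)^{ij}` for parities `i, j : ZMod 2`. -/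
def sg (i j : ZMod 2) : ℂ := (-1 : ℂ) ^ (i.val * j.val)

/-- The sign `(-1)^{i}` for a parity `i : ZMod 2`. -/
def sg1 (i : ZMod 2) : ℂ := (-1 : ℂ) ^ i.val

/-- The data of a Poisson vertex algebra structure on a unital associative
`ℂ`-superalgebra `P`: a `ℤ/2`-grading `part`, an even derivation `∂ = der`,
and a `λ`-bracket `{a_λ b} = ∑_{n≥0} (λⁿ/n!) (lb a b n)` with a support bound
`bnd`. -/
structure PVAData (P : Type) [Ring P] [Algebra ℂ P] where
  part : ZMod 2 → Submodule ℂ P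
  der : P →ₗ[ℂ] P
  lb : P →ₗ[ℂ] P →ₗ[ℂ] (ℕ → P)
  bnd : P → P → ℕ

namespace PVAData

variable {P : Type} [Ring P] [Algebra ℂ P] (d : PVAData P)

/-- The axioms of a Poisson vertex algebra (with its `ℤ/2`-grading):
`P` is a unital supercommutative associative differential superalgebra, and
the `λ`-bracket (written in coefficients, `{a_λ b} = ∑ λⁿ/n! · lb a b n`)
satisfies sesquilinearity, skewsymmetry, the Jacobi identity and the Leibniz
rule. -/
structure IsPVA : Prop where
  compl : IsCompl (d.part 0) (d.part 1)
  one_mem : (1 : P) ∈ d.part 0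
  mul_mem : ∀ (i j : ZMod 2), ∀ a ∈ d.part i, ∀ b ∈ d.part j,
    a * b ∈ d.part (i + j)
  scomm : ∀ (i j : ZMod 2), ∀ a ∈ d.part i, ∀ b ∈ d.part j,
    a * b = sg i j • (b * a)
  der_mem : ∀ (i : ZMod 2), ∀ a ∈ d.part i, d.der a ∈ d.part i
  der_mul : ∀ a b : P, d.der (a * b) = d.der a * b + a * d.der b
  lb_mem : ∀ (i j : ZMod 2), ∀ a ∈ d.part i, ∀ b ∈ d.part j, ∀ n,
    d.lb a b n ∈ d.part (i + j)
  lb_bnd : ∀ a b n, d.bnd a b ≤ n → d.lb a b n = 0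
  -- sesquilinearity: `{∂a_λ b} = -λ{a_λ b}`, `{a_λ ∂b} = (∂+λ){a_λ b}`
  sesq1₀ : ∀ a b : P, d.lb (d.der a) b 0 = 0
  sesq1 : ∀ (a b : P) (n : ℕ),
    d.lb (d.der a) b (n + 1) = -((n + 1 : ℕ) : ℂ) • d.lb a b n
  sesq2₀ : ∀ a b : P, d.lb a (d.der b) 0 = d.der (d.lb a b 0)
  sesq2 : ∀ (a b : P) (n : ℕ), d.lb a (d.der b) (n + 1) =
    d.der (d.lb a b (n + 1)) + ((n + 1 : ℕ) : ℂ) • d.lb a b n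
  -- skewsymmetry: `{a_λ b} = -(-1)^{p(a)p(b)} {b_{-λ-∂} a}`
  skew : ∀ (i j : ZMod 2), ∀ a ∈ d.part i, ∀ b ∈ d.part j, ∀ n,
    d.lb a b n = -sg i j • ∑ k ∈ Finset.range (d.bnd b a + 1),
      (((-1 : ℂ) ^ (n + k)) / (Nat.factorial k : ℂ)) •
        (d.der ^ k) (d.lb b a (n + k))
  -- Jacobi identity:
  -- `{a_λ{b_γ c}} = {{a_λ b}_{λ+γ} c} + (-1)^{p(a)p(b)}{b_γ{a_λ c}}`
  jacobi : ∀ (i j : ZMod 2), ∀ a ∈ d.part i, ∀ b ∈ d.part j, ∀ (c : P)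
    (m n : ℕ), d.lb a (d.lb b c n) m =
      (∑ k ∈ Finset.range (m + 1),
        ((Nat.choose m k : ℕ) : ℂ) • d.lb (d.lb a b k) c (m + n - k)) +
      sg i j • d.lb b (d.lb a c m) n
  -- Leibniz rule: `{a_λ bc} = {a_λ b}c + (-1)^{p(a)p(b)} b{a_λ c}`
  leibniz : ∀ (i j : ZMod 2), ∀ a ∈ d.part i, ∀ b ∈ d.part j, ∀ (c : P) (n : ℕ),
    d.lb a (b * c) n = d.lb a b n * c + sg i j • (b * d.lb a c n)

/-- The conformal weight space `P_Δ` of quasi-primary vectors for a candidate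
conformal vector `L`: elements `a` with
`{L_λ a} = (2∂ + 2Δλ)a + O(λ²)`. -/
def confWtSet (L : P) (Δ : ℝ) : Set P :=
  {a | d.lb L a 0 = (2 : ℂ) • d.der a ∧ d.lb L a 1 = ((2 * Δ : ℝ) : ℂ) • a}

/-- `L` is a conformal vector of central charge `c`:
`{L_λ L} = (2∂ + 4λ)L + (λ³/3)c` and `P` is the (bounded-below) sum of its
conformal weight spaces. -/
def IsConformalVector (L : P) (c : ℂ) : Prop :=
  L ∈ d.part 0 ∧
  d.lb L L 0 = (2 : ℂ) • d.der L ∧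
  d.lb L L 1 = (4 : ℂ) • L ∧
  d.lb L L 2 = 0 ∧
  d.lb L L 3 = (2 * c) • (1 : P) ∧
  (∀ n, 4 ≤ n → d.lb L L n = 0) ∧
  ∃ M : ℝ, (∀ Δ : ℝ, Δ < M → d.confWtSet L Δ ⊆ {0}) ∧
    Submodule.span ℂ (⋃ Δ : ℝ, d.confWtSet L Δ) = ⊤

/-- `a` is primary of conformal weight `Δ` with respect to `L`:
`{L_λ a} = (2∂ + 2Δλ)a` exactly. -/
def IsPrimary (L a : P) (Δ : ℝ) : Prop :=
  d.lb L a 0 = (2 : ℂ) • d.der a ∧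
  d.lb L a 1 = ((2 * Δ : ℝ) : ℂ) • a ∧
  ∀ n, 2 ≤ n → d.lb L a n = 0

end PVAData
/-- The data of an `N=1` SUSY Poisson vertex algebra structure on a unital
associative `ℂ`-superalgebra `P`: a `ℤ/2`-grading `part`, the even derivation
`∂ = der` and odd derivation `D = sder`, and the `Λ`-bracket
`{a_Λ b} = ∑_{n≥0} (λⁿ/n!) (lb0 a b n + χ · lb1 a b n)`
(components `lb0 a b n = a_{(n|0)} b`, `lb1 a b n = a_{(n|1)} b`). -/
structure SPVAData (P : Type) [Ring P] [Algebra ℂ P] where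
  part : ZMod 2 → Submodule ℂ P
  der : P →ₗ[ℂ] P
  sder : P →ₗ[ℂ] P
  lb0 : P →ₗ[ℂ] P →ₗ[ℂ] (ℕ → P)
  lb1 : P →ₗ[ℂ] P →ₗ[ℂ] (ℕ → P)
  bnd : P → P → ℕ

namespace SPVAData

variable {P : Type} [Ring P] [Algebra ℂ P] (d : SPVAData P)

/-- The axioms of an `N=1` SUSY Poisson vertex algebra, in terms of the
coefficients of the `Λ`-bracket
`{a_Λ b} = ∑_m (λᵐ/m!)(a_{(m|0)}b + χ a_{(m|1)}b)`, `Λ = (λ,χ)`, χ² = -λ: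
`P` is a unital supercommutative associative superalgebra with even derivation
`∂` and odd derivation `D`, `D² = ∂`, and the bracket is odd and satisfies
sesquilinearity (`{Da_Λ b} = χ{a_Λ b}`,
`{a_Λ Db} = (-1)^{p(a)+1}(D+χ){a_Λ b}`), skewsymmetry
(`{a_Λ b} = (-1)^{p(a)p(b)}{b_{-Λ-∇} a}`), the `N=1` SUSY Jacobi identity and
the Leibniz rule. -/
structure IsSPVA : Prop where
  compl : IsCompl (d.part 0) (d.part 1)
  one_mem : (1 : P) ∈ d.part 0
  mul_mem : ∀ (i j : ZMod 2), ∀ a ∈ d.part i, ∀ b ∈ d.part j,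
    a * b ∈ d.part (i + j)
  scomm : ∀ (i j : ZMod 2), ∀ a ∈ d.part i, ∀ b ∈ d.part j,
    a * b = sg i j • (b * a)
  der_mem : ∀ (i : ZMod 2), ∀ a ∈ d.part i, d.der a ∈ d.part i
  der_mul : ∀ a b : P, d.der (a * b) = d.der a * b + a * d.der b
  sder_mem : ∀ (i : ZMod 2), ∀ a ∈ d.part i, d.sder a ∈ d.part (i + 1)
  sder_mul : ∀ (i : ZMod 2), ∀ a ∈ d.part i, ∀ b : P,
    d.sder (a * b) = d.sder a * b + sg1 i • (a * d.sder b)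
  sder_sq : ∀ a : P, d.sder (d.sder a) = d.der a
  lb0_mem : ∀ (i j : ZMod 2), ∀ a ∈ d.part i, ∀ b ∈ d.part j, ∀ n,
    d.lb0 a b n ∈ d.part (i + j + 1)
  lb1_mem : ∀ (i j : ZMod 2), ∀ a ∈ d.part i, ∀ b ∈ d.part j, ∀ n,
    d.lb1 a b n ∈ d.part (i + j)
  lb0_bnd : ∀ a b n, d.bnd a b ≤ n → d.lb0 a b n = 0
  lb1_bnd : ∀ a b n, d.bnd a b ≤ n → d.lb1 a b n = 0
  -- sesquilinearity in the first argument: `{Da_Λ b} = χ{a_Λ b}`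
  sesq1₀ : ∀ a b : P, d.lb0 (d.sder a) b 0 = 0
  sesq1 : ∀ (a b : P) (n : ℕ),
    d.lb0 (d.sder a) b (n + 1) = -((n + 1 : ℕ) : ℂ) • d.lb1 a b n
  sesq1' : ∀ (a b : P) (n : ℕ), d.lb1 (d.sder a) b n = d.lb0 a b n
  -- sesquilinearity in the second argument:
  -- `{a_Λ Db} = (-1)^{p(a)+1}(D+χ){a_Λ b}`
  sesq2₀ : ∀ (i : ZMod 2), ∀ a ∈ d.part i, ∀ b : P,
    d.lb0 a (d.sder b) 0 = sg1 (i + 1) • d.sder (d.lb0 a b 0)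
  sesq2 : ∀ (i : ZMod 2), ∀ a ∈ d.part i, ∀ (b : P) (n : ℕ),
    d.lb0 a (d.sder b) (n + 1) = sg1 (i + 1) •
      (d.sder (d.lb0 a b (n + 1)) + ((n + 1 : ℕ) : ℂ) • d.lb1 a b n)
  sesq2' : ∀ (i : ZMod 2), ∀ a ∈ d.part i, ∀ (b : P) (n : ℕ),
    d.lb1 a (d.sder b) n = sg1 (i + 1) •
      (d.lb0 a b n - d.sder (d.lb1 a b n))
  -- skewsymmetry: `{a_Λ b} = (-1)^{p(a)p(b)} {b_{-Λ-∇} a}`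
  skew0 : ∀ (i j : ZMod 2), ∀ a ∈ d.part i, ∀ b ∈ d.part j, ∀ n,
    d.lb0 a b n = sg i j • ∑ k ∈ Finset.range (d.bnd b a + 1),
      (((-1 : ℂ) ^ (n + k)) / (Nat.factorial k : ℂ)) •
        (d.der ^ k) (d.lb0 b a (n + k) - d.sder (d.lb1 b a (n + k)))
  skew1 : ∀ (i j : ZMod 2), ∀ a ∈ d.part i, ∀ b ∈ d.part j, ∀ n,
    d.lb1 a b n = -sg i j • ∑ k ∈ Finset.range (d.bnd b a + 1),
      (((-1 : ℂ) ^ (n + k)) / (Nat.factorial k : ℂ)) •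
        (d.der ^ k) (d.lb1 b a (n + k))
  -- the `N=1` SUSY Jacobi identity
  -- `{a_Λ{b_Γ c}} = (-1)^{p(a)+1}{{a_Λ b}_{Γ+Λ} c}
  --                + (-1)^{(p(a)+1)(p(b)+1)}{b_Γ{a_Λ c}}`,
  -- written out in the components `1, χ, η, χη` of `C[λ,γ,χ,η] ⊗ P`
  jacobi00 : ∀ (i j : ZMod 2), ∀ a ∈ d.part i, ∀ b ∈ d.part j, ∀ (c : P)
    (m n : ℕ), d.lb0 a (d.lb0 b c n) m = sg1 (i + 1) •
      ((∑ k ∈ Finset.range (m + 1),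
        ((Nat.choose m k : ℕ) : ℂ) • d.lb0 (d.lb0 a b k) c (m + n - k)) +
       (∑ k ∈ Finset.range m,
        (((k + 1) * Nat.choose m (k + 1) : ℕ) : ℂ) •
          d.lb1 (d.lb1 a b k) c (m + n - k - 1))) +
      sg (i + 1) (j + 1) • d.lb0 b (d.lb0 a c m) n
  jacobi10 : ∀ (i j : ZMod 2), ∀ a ∈ d.part i, ∀ b ∈ d.part j, ∀ (c : P)
    (m n : ℕ), d.lb1 a (d.lb0 b c n) m = sg1 (i + 1) •
      (∑ k ∈ Finset.range (m + 1), ((Nat.choose m k : ℕ) : ℂ) •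
        (d.lb1 (d.lb0 a b k) c (m + n - k) - d.lb0 (d.lb1 a b k) c (m + n - k))) +
      (sg (i + 1) (j + 1) * sg1 (j + 1)) • d.lb0 b (d.lb1 a c m) n
  jacobi01 : ∀ (i j : ZMod 2), ∀ a ∈ d.part i, ∀ b ∈ d.part j, ∀ (c : P)
    (m n : ℕ), sg1 (i + 1) • d.lb0 a (d.lb1 b c n) m = sg1 (i + 1) •
      (∑ k ∈ Finset.range (m + 1),
        ((Nat.choose m k : ℕ) : ℂ) • d.lb1 (d.lb0 a b k) c (m + n - k)) +
      sg (i + 1) (j + 1) • d.lb1 b (d.lb0 a c m) n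
  jacobi11 : ∀ (i j : ZMod 2), ∀ a ∈ d.part i, ∀ b ∈ d.part j, ∀ (c : P)
    (m n : ℕ), sg1 i • d.lb1 a (d.lb1 b c n) m = sg1 i •
      (∑ k ∈ Finset.range (m + 1),
        ((Nat.choose m k : ℕ) : ℂ) • d.lb1 (d.lb1 a b k) c (m + n - k)) +
      (sg (i + 1) (j + 1) * sg1 (j + 1)) • d.lb1 b (d.lb1 a c m) n
  -- the Leibniz rule `{a_Λ bc} = {a_Λ b}c + (-1)^{(p(a)+1)p(b)} b{a_Λ c}`
  leibniz0 : ∀ (i j : ZMod 2), ∀ a ∈ d.part i, ∀ b ∈ d.part j, ∀ (c : P) (n : ℕ),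
    d.lb0 a (b * c) n = d.lb0 a b n * c + sg (i + 1) j • (b * d.lb0 a c n)
  leibniz1 : ∀ (i j : ZMod 2), ∀ a ∈ d.part i, ∀ b ∈ d.part j, ∀ (c : P) (n : ℕ),
    d.lb1 a (b * c) n = d.lb1 a b n * c + sg i j • (b * d.lb1 a c n)

/-- The conformal weight space of quasi-primary vectors for a candidate
`N=1` superconformal vector `G`: elements `a` with
`{G_Λ a} = (2∂ + 2Δλ + χD)a + O(Λ²)`. -/
def sconfWtSet (G : P) (Δ : ℝ) : Set P :=
  {a | d.lb0 G a 0 = (2 : ℂ) • d.der a ∧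
       d.lb0 G a 1 = ((2 * Δ : ℝ) : ℂ) • a ∧
       d.lb1 G a 0 = d.sder a}

/-- `G` is an `N=1` superconformal vector of central charge `c`:
`G` is odd, `{G_Λ G} = (2∂ + 3λ + χD)G + (λ²χ/3)c`, and `P` is the
(bounded-below) sum of the conformal weight spaces of `G`. -/
def IsSuperconformal (G : P) (c : ℂ) : Prop :=
  G ∈ d.part 1 ∧
  d.lb0 G G 0 = (2 : ℂ) • d.der G ∧
  d.lb0 G G 1 = (3 : ℂ) • G ∧
  (∀ n, 2 ≤ n → d.lb0 G G n = 0) ∧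
  d.lb1 G G 0 = d.sder G ∧
  d.lb1 G G 1 = 0 ∧
  d.lb1 G G 2 = (2 * c / 3) • (1 : P) ∧
  (∀ n, 3 ≤ n → d.lb1 G G n = 0) ∧
  ∃ M : ℝ, (∀ Δ : ℝ, Δ < M → d.sconfWtSet G Δ ⊆ {0}) ∧
    Submodule.span ℂ (⋃ Δ : ℝ, d.sconfWtSet G Δ) = ⊤

/-- `a` is primary of conformal weight `Δ` with respect to the `N=1`
superconformal vector `G`: `{G_Λ a} = (2∂ + 2Δλ + χD)a` exactly. -/
def IsPrimary (G a : P) (Δ : ℝ) : Prop :=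
  d.lb0 G a 0 = (2 : ℂ) • d.der a ∧
  d.lb0 G a 1 = ((2 * Δ : ℝ) : ℂ) • a ∧
  (∀ n, 2 ≤ n → d.lb0 G a n = 0) ∧
  d.lb1 G a 0 = d.sder a ∧
  (∀ n, 1 ≤ n → d.lb1 G a n = 0)

end SPVAData
/-- The data of an `N=2` SUSY Poisson vertex algebra structure: a
`ℤ/2`-grading, the even derivation `∂ = der`, two odd derivations
`D = sder1`, `D̃ = sder2`, and the `Λ`-bracket
`{a_Λ b} = ∑_n (λⁿ/n!)(a_{(n|00)}b - χ a_{(n|10)}b + χ̃ a_{(n|01)}b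
- χχ̃ a_{(n|11)}b)`, with components `lb00, lb10, lb01, lb11`. -/
structure S2PVAData (P : Type) [Ring P] [Algebra ℂ P] where
  part : ZMod 2 → Submodule ℂ P
  der : P →ₗ[ℂ] P
  sder1 : P →ₗ[ℂ] P
  sder2 : P →ₗ[ℂ] P
  lb00 : P →ₗ[ℂ] P →ₗ[ℂ] (ℕ → P)
  lb10 : P →ₗ[ℂ] P →ₗ[ℂ] (ℕ → P)
  lb01 : P →ₗ[ℂ] P →ₗ[ℂ] (ℕ → P)
  lb11 : P →ₗ[ℂ] P →ₗ[ℂ] (ℕ → P)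
  bnd : P → P → ℕ

namespace S2PVAData

variable {P : Type} [Ring P] [Algebra ℂ P] (d : S2PVAData P)

/-- The underlying `N=0` Poisson vertex algebra data, with `λ`-bracket the
`(n|11)`-component of the `Λ`-bracket. -/
def toPVAData : PVAData P :=
  { part := d.part, der := d.der, lb := d.lb11, bnd := d.bnd }

/-- The axioms of an `N=2` SUSY Poisson vertex algebra.  By the sesquilinearity
of the `Λ`-bracket, an `N=2` SUSY PVA structure is equivalent to the data of a
Poisson vertex algebra structure for the `λ`-bracket
`{a_λ b} = ∑ (λⁿ/n!) a_{(n|11)} b` together with two supercommuting odd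
derivations `D, D̃` with `D² = D̃² = ∂`, both compatible with the `λ`-bracket,
the remaining components being recovered by
`{a_Λ b} = {D̃Da_λ b} - χ{D̃a_λ b} + χ̃{Da_λ b} - χχ̃{a_λ b}`;
this is the form in which we state the axioms. -/
structure IsS2PVA : Prop where
  pva : d.toPVAData.IsPVA
  sder1_mem : ∀ (i : ZMod 2), ∀ a ∈ d.part i, d.sder1 a ∈ d.part (i + 1)
  sder2_mem : ∀ (i : ZMod 2), ∀ a ∈ d.part i, d.sder2 a ∈ d.part (i + 1)
  sder1_mul : ∀ (i : ZMod 2), ∀ a ∈ d.part i, ∀ b : P,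
    d.sder1 (a * b) = d.sder1 a * b + sg1 i • (a * d.sder1 b)
  sder2_mul : ∀ (i : ZMod 2), ∀ a ∈ d.part i, ∀ b : P,
    d.sder2 (a * b) = d.sder2 a * b + sg1 i • (a * d.sder2 b)
  sder1_sq : ∀ a : P, d.sder1 (d.sder1 a) = d.der a
  sder2_sq : ∀ a : P, d.sder2 (d.sder2 a) = d.der a
  anticomm : ∀ a : P, d.sder1 (d.sder2 a) + d.sder2 (d.sder1 a) = 0
  sder1_lb : ∀ (i : ZMod 2), ∀ a ∈ d.part i, ∀ (b : P) (n : ℕ),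
    d.sder1 (d.lb11 a b n) = d.lb11 (d.sder1 a) b n + sg1 i • d.lb11 a (d.sder1 b) n
  sder2_lb : ∀ (i : ZMod 2), ∀ a ∈ d.part i, ∀ (b : P) (n : ℕ),
    d.sder2 (d.lb11 a b n) = d.lb11 (d.sder2 a) b n + sg1 i • d.lb11 a (d.sder2 b) n
  comp01 : ∀ (a b : P) (n : ℕ), d.lb01 a b n = d.lb11 (d.sder1 a) b n
  comp10 : ∀ (a b : P) (n : ℕ), d.lb10 a b n = d.lb11 (d.sder2 a) b n
  comp00 : ∀ (a b : P) (n : ℕ), d.lb00 a b n = d.lb11 (d.sder2 (d.sder1 a)) b n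

/-- The conformal weight space of quasi-primary vectors for a candidate
`N=2` superconformal vector `J`: elements `a` with
`{J_Λ a} = (2∂ + 2Δλ + χD + χ̃D̃)a + O(Λ²)`. -/
def s2confWtSet (J : P) (Δ : ℝ) : Set P :=
  {a | d.lb00 J a 0 = (2 : ℂ) • d.der a ∧
       d.lb00 J a 1 = ((2 * Δ : ℝ) : ℂ) • a ∧
       d.lb10 J a 0 = -d.sder1 a ∧
       d.lb01 J a 0 = d.sder2 a}

/-- The `N=2` superconformal self-bracket relation
`{J_Λ J} = (2∂ + 2λ + χD + χ̃D̃)J + (λχχ̃/3)c` of Definition 3.4 (i),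
in components. -/
def SelfBracketRel (J : P) (c : ℂ) : Prop :=
  d.lb00 J J 0 = (2 : ℂ) • d.der J ∧
  d.lb00 J J 1 = (2 : ℂ) • J ∧
  (∀ n, 2 ≤ n → d.lb00 J J n = 0) ∧
  d.lb10 J J 0 = -d.sder1 J ∧
  (∀ n, 1 ≤ n → d.lb10 J J n = 0) ∧
  d.lb01 J J 0 = d.sder2 J ∧
  (∀ n, 1 ≤ n → d.lb01 J J n = 0) ∧
  d.lb11 J J 0 = 0 ∧
  d.lb11 J J 1 = (-(c / 3)) • (1 : P) ∧
  (∀ n, 2 ≤ n → d.lb11 J J n = 0)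

/-- `J` is an `N=2` superconformal vector of central charge `c`. -/
def IsSuperconformal (J : P) (c : ℂ) : Prop :=
  J ∈ d.part 0 ∧ d.SelfBracketRel J c ∧
  ∃ M : ℝ, (∀ Δ : ℝ, Δ < M → d.s2confWtSet J Δ ⊆ {0}) ∧
    Submodule.span ℂ (⋃ Δ : ℝ, d.s2confWtSet J Δ) = ⊤

/-- `a` is primary of conformal weight `Δ` with respect to the `N=2`
superconformal vector `J`: `{J_Λ a} = (2∂ + 2Δλ + χD + χ̃D̃)a` exactly. -/
def IsPrimary (J a : P) (Δ : ℝ) : Prop :=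
  d.lb00 J a 0 = (2 : ℂ) • d.der a ∧
  d.lb00 J a 1 = ((2 * Δ : ℝ) : ℂ) • a ∧
  (∀ n, 2 ≤ n → d.lb00 J a n = 0) ∧
  d.lb10 J a 0 = -d.sder1 a ∧
  (∀ n, 1 ≤ n → d.lb10 J a n = 0) ∧
  d.lb01 J a 0 = d.sder2 a ∧
  (∀ n, 1 ≤ n → d.lb01 J a n = 0) ∧
  (∀ n, d.lb11 J a n = 0)

end S2PVAData
/-- The `N=0` Poisson vertex algebra data induced from an `N=1` SUSY PVA
structure: the `λ`-bracket is `{a_λ b} = ∑ (λⁿ/n!) a_{(n|1)} b`. -/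
def SPVAData.toPVAData {P : Type} [Ring P] [Algebra ℂ P] (d : SPVAData P) :
    PVAData P :=
  { part := d.part, der := d.der, lb := d.lb1, bnd := d.bnd }

/-- The first `N=1` SUSY PVA data induced from an `N=2` SUSY PVA structure:
`{a_Λ b} = ∑ (λⁿ/n!)(a_{(n|01)}b + χ a_{(n|11)}b)`, with odd derivation `D`. -/
def S2PVAData.toSPVAData₁ {P : Type} [Ring P] [Algebra ℂ P] (d : S2PVAData P) :
    SPVAData P :=
  { part := d.part, der := d.der, sder := d.sder1,
    lb0 := d.lb01, lb1 := d.lb11, bnd := d.bnd }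

/-- The second `N=1` SUSY PVA data induced from an `N=2` SUSY PVA structure:
`{a_Λ̃ b} = ∑ (λⁿ/n!)(a_{(n|10)}b + χ̃ a_{(n|11)}b)`, with odd derivation `D̃`. -/
def S2PVAData.toSPVAData₂ {P : Type} [Ring P] [Algebra ℂ P] (d : S2PVAData P) :
    SPVAData P :=
  { part := d.part, der := d.der, sder := d.sder2,
    lb0 := d.lb10, lb1 := d.lb11, bnd := d.bnd }

/-- The `N=1` SUSY bracket data induced from a `λ`-bracket and an odd
endomorphism `D`: `{a_Λ b}⁻ = {Da_λ b} + χ{a_λ b}`. -/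
def PVAData.inducedSPVA {P : Type} [Ring P] [Algebra ℂ P] (d : PVAData P)
    (D : P →ₗ[ℂ] P) : SPVAData P :=
  { part := d.part, der := d.der, sder := D,
    lb0 := d.lb.comp D, lb1 := d.lb,
    bnd := fun a b => max (d.bnd (D a) b) (d.bnd a b) }

/-- The `N=2` SUSY bracket data induced from a `λ`-bracket and two odd
endomorphisms `D, D̃`:
`{a_Λ b}⁻ = {D̃Da_λ b} - χ{D̃a_λ b} + χ̃{Da_λ b} - χχ̃{a_λ b}`. -/
def PVAData.inducedS2PVA {P : Type} [Ring P] [Algebra ℂ P] (d : PVAData P)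
    (D Dt : P →ₗ[ℂ] P) : S2PVAData P :=
  { part := d.part, der := d.der, sder1 := D, sder2 := Dt,
    lb00 := d.lb.comp (Dt ∘ₗ D), lb10 := d.lb.comp Dt,
    lb01 := d.lb.comp D, lb11 := d.lb,
    bnd := fun a b =>
      max (max (d.bnd (Dt (D a)) b) (d.bnd (Dt a) b))
        (max (d.bnd (D a) b) (d.bnd a b)) }
/-- The target axioms: `(A, part, der)` is a unital supercommutative
associative differential `ℂ`-superalgebra with even derivation `der`. -/
def SuperDiffTargetOK (A : Type) [Ring A] [Algebra ℂ A]
    (part : ZMod 2 → Submodule ℂ A) (der : A →ₗ[ℂ] A) : Prop :=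
  IsCompl (part 0) (part 1) ∧ (1 : A) ∈ part 0 ∧
  (∀ (i j : ZMod 2), ∀ a ∈ part i, ∀ b ∈ part j, a * b ∈ part (i + j)) ∧
  (∀ (i j : ZMod 2), ∀ a ∈ part i, ∀ b ∈ part j, a * b = sg i j • (b * a)) ∧
  (∀ (i : ZMod 2), ∀ a ∈ part i, der a ∈ part i) ∧
  (∀ a b : A, der (a * b) = der a * b + a * der b)

/-- `(A, part)` has an odd derivation `sd` with `sd² = der`. -/
def OddDerOK (A : Type) [Ring A] [Algebra ℂ A]
    (part : ZMod 2 → Submodule ℂ A) (der sd : A →ₗ[ℂ] A) : Prop :=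
  (∀ (i : ZMod 2), ∀ a ∈ part i, sd a ∈ part (i + 1)) ∧
  (∀ (i : ZMod 2), ∀ a ∈ part i, ∀ b : A,
    sd (a * b) = sd a * b + sg1 i • (a * sd b)) ∧
  (∀ a : A, sd (sd a) = der a)

/-- The family `x : ι → P` (of parities `px`) freely generates `P` as a
`ℂ[∂]`-differential superalgebra: universal property with respect to unital
supercommutative associative differential `ℂ`-superalgebras. -/
def FreelyGenerates₀ (P : Type) [Ring P] [Algebra ℂ P]
    (part : ZMod 2 → Submodule ℂ P) (der : P →ₗ[ℂ] P)
    {ι : Type} (x : ι → P) (px : ι → ZMod 2) : Prop :=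
  ∀ (A : Type) [Ring A] [Algebra ℂ A], ∀ (pA : ZMod 2 → Submodule ℂ A)
    (dA : A →ₗ[ℂ] A), SuperDiffTargetOK A pA dA →
    ∀ y : ι → A, (∀ i, y i ∈ pA (px i)) →
    ∃! φ : P →ₐ[ℂ] A, (∀ i, φ (x i) = y i) ∧
      (∀ p : P, φ (der p) = dA (φ p)) ∧
      (∀ j : ZMod 2, ∀ a ∈ part j, φ a ∈ pA j)

/-- The family `x : ι → P` (of parities `px`) freely generates `P` as a
`ℂ[∂,D] = ℂ[∇]`-differential superalgebra (`N=1`): universal property with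
respect to supercommutative differential superalgebras with an odd derivation
`D` satisfying `D² = ∂`. -/
def FreelyGenerates₁ (P : Type) [Ring P] [Algebra ℂ P]
    (part : ZMod 2 → Submodule ℂ P) (der sder : P →ₗ[ℂ] P)
    {ι : Type} (x : ι → P) (px : ι → ZMod 2) : Prop :=
  ∀ (A : Type) [Ring A] [Algebra ℂ A], ∀ (pA : ZMod 2 → Submodule ℂ A)
    (dA sA : A →ₗ[ℂ] A), SuperDiffTargetOK A pA dA → OddDerOK A pA dA sA →
    ∀ y : ι → A, (∀ i, y i ∈ pA (px i)) →
    ∃! φ : P →ₐ[ℂ] A, (∀ i, φ (x i) = y i) ∧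
      (∀ p : P, φ (der p) = dA (φ p)) ∧
      (∀ p : P, φ (sder p) = sA (φ p)) ∧
      (∀ j : ZMod 2, ∀ a ∈ part j, φ a ∈ pA j)

/-- The family `x : ι → P` (of parities `px`) freely generates `P` as a
`ℂ[∂,D,D̃] = ℂ[∇]`-differential superalgebra (`N=2`): universal property with
respect to supercommutative differential superalgebras with two supercommuting
odd derivations `D, D̃` squaring to `∂`. -/
def FreelyGenerates₂ (P : Type) [Ring P] [Algebra ℂ P]
    (part : ZMod 2 → Submodule ℂ P) (der sder1 sder2 : P →ₗ[ℂ] P)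
    {ι : Type} (x : ι → P) (px : ι → ZMod 2) : Prop :=
  ∀ (A : Type) [Ring A] [Algebra ℂ A], ∀ (pA : ZMod 2 → Submodule ℂ A)
    (dA sA tA : A →ₗ[ℂ] A), SuperDiffTargetOK A pA dA →
    OddDerOK A pA dA sA → OddDerOK A pA dA tA →
    (∀ a : A, sA (tA a) + tA (sA a) = 0) →
    ∀ y : ι → A, (∀ i, y i ∈ pA (px i)) →
    ∃! φ : P →ₐ[ℂ] A, (∀ i, φ (x i) = y i) ∧
      (∀ p : P, φ (der p) = dA (φ p)) ∧
      (∀ p : P, φ (sder1 p) = sA (φ p)) ∧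
      (∀ p : P, φ (sder2 p) = tA (φ p)) ∧
      (∀ j : ZMod 2, ∀ a ∈ part j, φ a ∈ pA j)

/-- The operator `a ↦ G_{(0)} a` (zeroth coefficient of the `λ`-bracket with a
fixed element `G`), as a linear endomorphism. -/
def PVAData.ad0 {P : Type} [Ring P] [Algebra ℂ P] (d : PVAData P) (G : P) :
    P →ₗ[ℂ] P where
  toFun x := d.lb G x 0
  map_add' x y := by simp
  map_smul' c x := by simp

/-- The operator `a ↦ J_{(0|0)} a` (the `(0|0)`-coefficient of the
`Λ`-bracket with a fixed element `J`), as a linear endomorphism. -/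
def SPVAData.ad00 {P : Type} [Ring P] [Algebra ℂ P] (d : SPVAData P) (J : P) :
    P →ₗ[ℂ] P where
  toFun x := d.lb0 J x 0
  map_add' x y := by simp
  map_smul' c x := by simp

theorem zmod2_cases (i : ZMod 2) : i = 0 ∨ i = 1 := by
  revert i; decide

theorem sg_zero_left (j : ZMod 2) : sg 0 j = 1 := by simp [sg]

theorem sg_one_left (j : ZMod 2) : sg 1 j = sg1 j := by simp [sg, sg1, ZMod.val_one]

theorem sg1_zero : sg1 0 = 1 := by simp [sg1]

theorem sg1_one : sg1 1 = -1 := by simp [sg1, ZMod.val_one]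

theorem sg1_add_one (i : ZMod 2) : sg1 (i + 1) = -sg1 i := by
  rcases zmod2_cases i with rfl | rfl
  · simp [sg1_zero, sg1_one]
  · simp [sg1_zero, sg1_one, show (1 + 1 : ZMod 2) = 0 from rfl]

theorem sg1_mul_self (i : ZMod 2) : sg1 i * sg1 i = 1 := by
  rcases zmod2_cases i with rfl | rfl <;> simp [sg1_zero, sg1_one]

theorem sg1_smul_smul {M : Type*} [AddCommGroup M] [Module ℂ M] (i : ZMod 2) (x : M) :
    sg1 i • sg1 i • x = x := by
  rw [smul_smul, sg1_mul_self, one_smul]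

theorem sg_add_one_mul (i j : ZMod 2) :
    sg1 i * (sg (i + 1) (j + 1) * sg1 (j + 1)) = sg i j := by
  rcases zmod2_cases i with rfl | rfl <;> rcases zmod2_cases j with rfl | rfl <;>
    simp [sg_zero_left, sg_one_left, sg1_zero, sg1_one, show (1 + 1 : ZMod 2) = 0 from rfl]

/-- Linear maps which agree on homogeneous elements are equal. -/
theorem eq_of_eq_on_parts {P M : Type*} [AddCommGroup P] [Module ℂ P]
    [AddCommGroup M] [Module ℂ M] {part : ZMod 2 → Submodule ℂ P}
    (hc : IsCompl (part 0) (part 1)) {f g : P →ₗ[ℂ] M}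
    (hfg : ∀ i, ∀ a ∈ part i, f a = g a) : f = g := by
  ext x
  obtain ⟨y, hy, z, hz, rfl⟩ := Submodule.mem_sup.1
    (hc.sup_eq_top ▸ Submodule.mem_top : x ∈ part 0 ⊔ part 1)
  rw [map_add, map_add, hfg 0 y hy, hfg 1 z hz]

theorem SPVAData.ad00_apply {P : Type} [Ring P] [Algebra ℂ P] (d : SPVAData P) (J a : P) :
    d.ad00 J a = d.lb0 J a 0 := rfl

namespace SPVAData.IsSPVA

variable {P : Type} [Ring P] [Algebra ℂ P] {d : SPVAData P}

theorem superDiffTargetOK (h : d.IsSPVA) : SuperDiffTargetOK P d.part d.der :=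
  ⟨h.compl, h.one_mem, h.mul_mem, h.scomm, h.der_mem, h.der_mul⟩

theorem oddDerOK (h : d.IsSPVA) : OddDerOK P d.part d.der d.sder :=
  ⟨h.sder_mem, h.sder_mul, h.sder_sq⟩

theorem lb1_der_left_zero (h : d.IsSPVA) (a b : P) : d.lb1 (d.der a) b 0 = 0 := by
  rw [← h.sder_sq, h.sesq1', h.sesq1₀]

theorem lb1_der_left_succ (h : d.IsSPVA) (a b : P) (n : ℕ) :
    d.lb1 (d.der a) b (n + 1) = -((n + 1 : ℕ) : ℂ) • d.lb1 a b n := by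
  rw [← h.sder_sq, h.sesq1', h.sesq1]

theorem lb0_der_left_succ (h : d.IsSPVA) (a b : P) (n : ℕ) :
    d.lb0 (d.der a) b (n + 1) = -((n + 1 : ℕ) : ℂ) • d.lb0 a b n := by
  rw [← h.sder_sq, h.sesq1, h.sesq1']

theorem lb1_der_right_zero (h : d.IsSPVA) (a b : P) :
    d.lb1 a (d.der b) 0 = d.der (d.lb1 a b 0) := by
  have key : LinearMap.proj 0 ∘ₗ d.lb1.flip (d.der b) =
      d.der ∘ₗ LinearMap.proj 0 ∘ₗ d.lb1.flip b := by
    refine eq_of_eq_on_parts h.compl fun i a ha => ?_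
    simp only [LinearMap.comp_apply, LinearMap.proj_apply, LinearMap.flip_apply]
    rw [← h.sder_sq b, h.sesq2' i a ha, h.sesq2₀ i a ha, h.sesq2' i a ha, map_smul,
      ← smul_sub, sg1_smul_smul, map_sub, h.sder_sq]
    abel
  exact LinearMap.congr_fun key a

theorem lb1_der_right_succ (h : d.IsSPVA) (a b : P) (n : ℕ) :
    d.lb1 a (d.der b) (n + 1) =
      d.der (d.lb1 a b (n + 1)) + ((n + 1 : ℕ) : ℂ) • d.lb1 a b n := by
  have key : LinearMap.proj (n + 1) ∘ₗ d.lb1.flip (d.der b) =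
      d.der ∘ₗ LinearMap.proj (n + 1) ∘ₗ d.lb1.flip b +
        ((n + 1 : ℕ) : ℂ) • (LinearMap.proj n ∘ₗ d.lb1.flip b) := by
    refine eq_of_eq_on_parts h.compl fun i a ha => ?_
    simp only [LinearMap.comp_apply, LinearMap.proj_apply, LinearMap.flip_apply,
      LinearMap.add_apply, LinearMap.smul_apply]
    rw [← h.sder_sq b, h.sesq2' i a ha, h.sesq2 i a ha, h.sesq2' i a ha, map_smul,
      ← smul_sub, sg1_smul_smul, map_sub, h.sder_sq]
    abel
  exact LinearMap.congr_fun key a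

/-- The `(n|1)`-products of an `N=1` SUSY PVA form a PVA, whatever larger support bound
is recorded. -/
theorem isPVA_of_le_bnd (h : d.IsSPVA) {bnd : P → P → ℕ} (hb : ∀ a b, d.bnd a b ≤ bnd a b) :
    PVAData.IsPVA { part := d.part, der := d.der, lb := d.lb1, bnd := bnd } where
  compl := h.compl
  one_mem := h.one_mem
  mul_mem := h.mul_mem
  scomm := h.scomm
  der_mem := h.der_mem
  der_mul := h.der_mul
  lb_mem := h.lb1_mem
  lb_bnd a b n hn := h.lb1_bnd a b n ((hb a b).trans hn)
  sesq1₀ := h.lb1_der_left_zero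
  sesq1 := h.lb1_der_left_succ
  sesq2₀ := h.lb1_der_right_zero
  sesq2 := h.lb1_der_right_succ
  skew i j a ha b hb' n := by
    refine (h.skew1 i j a ha b hb' n).trans ?_
    congr 1
    refine Finset.sum_subset (Finset.range_mono (Nat.succ_le_succ (hb b a))) fun k _ hk => ?_
    have hk' : d.bnd b a ≤ n + k := by
      simp only [Finset.mem_range] at hk
      omega
    rw [h.lb1_bnd b a _ hk', map_zero, smul_zero]
  jacobi i j a ha b hb' c m n := by
    have hj := congrArg (sg1 i • ·) (h.jacobi11 i j a ha b hb' c m n)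
    simpa only [smul_add, sg1_smul_smul, smul_smul, sg_add_one_mul, sg1_mul_self, one_smul]
      using hj
  leibniz := h.leibniz1

theorem sder_lb1 (h : d.IsSPVA) {i : ZMod 2} {a : P} (ha : a ∈ d.part i) (b : P) (n : ℕ) :
    d.sder (d.lb1 a b n) = d.lb1 (d.sder a) b n + sg1 i • d.lb1 a (d.sder b) n := by
  rw [h.sesq1', h.sesq2' i a ha, sg1_add_one, neg_smul, smul_neg, sg1_smul_smul]
  abel

variable {J : P}

theorem ad00_mem (h : d.IsSPVA) (hJ : J ∈ d.part 0) (i : ZMod 2) (a : P) (ha : a ∈ d.part i) :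
    d.ad00 J a ∈ d.part (i + 1) := by
  simpa [ad00_apply] using h.lb0_mem 0 i J hJ a ha 0

theorem ad00_mul (h : d.IsSPVA) (hJ : J ∈ d.part 0) (i : ZMod 2) (a : P) (ha : a ∈ d.part i)
    (b : P) : d.ad00 J (a * b) = d.ad00 J a * b + sg1 i • (a * d.ad00 J b) := by
  simpa [ad00_apply, sg_one_left] using h.leibniz0 0 i J hJ a ha b 0

theorem ad00_sder (h : d.IsSPVA) (hJ : J ∈ d.part 0) (a : P) :
    d.ad00 J (d.sder a) = -d.sder (d.ad00 J a) := by
  simpa [ad00_apply, sg1_one] using h.sesq2₀ 0 J hJ a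

theorem ad00_lb1 (h : d.IsSPVA) (hJ : J ∈ d.part 0) {i : ZMod 2} {a : P} (ha : a ∈ d.part i)
    (b : P) (n : ℕ) :
    d.ad00 J (d.lb1 a b n) = d.lb1 (d.ad00 J a) b n + sg1 i • d.lb1 a (d.ad00 J b) n := by
  have hj := congrArg Neg.neg (h.jacobi01 0 i J hJ a ha b 0 n)
  simpa [ad00_apply, sg_one_left, sg1_one, sg1_add_one, add_comm] using hj

/-- A self-bracket `{J_Λ J} = -G + O(Λ)` makes `J_{(0|0)}` a square root of
`G_{(0|0)} / 2`. -/
theorem two_smul_ad00_ad00 (h : d.IsSPVA) (hJ : J ∈ d.part 0) {G : P}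
    (hJJ : d.lb0 J J 0 = -G) (a : P) :
    (2 : ℂ) • d.ad00 J (d.ad00 J a) = d.lb0 G a 0 := by
  have hj := h.jacobi00 0 0 J hJ J hJ a 0 0
  simp [sg_one_left, sg1_one, hJJ] at hj
  change (2 : ℂ) • d.lb0 J (d.lb0 J a 0) 0 = _
  rw [two_smul]
  nth_rewrite 1 [hj]
  abel

theorem lb0_eq_two_smul_der {G : P} {c : ℂ} (hG : d.IsSuperconformal G c) (a : P) :
    d.lb0 G a 0 = (2 : ℂ) • d.der a := by
  obtain ⟨-, -, -, -, -, -, -, -, M, -, hspan⟩ := hG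
  have key : d.ad00 G = (2 : ℂ) • d.der := by
    refine LinearMap.ext_on hspan fun x hx => ?_
    obtain ⟨Δ, hx⟩ := Set.mem_iUnion.1 hx
    exact hx.1
  exact LinearMap.congr_fun key a

/-- If `{J_Λ J} = -G + O(Λ)` with `G` superconformal and `J` primary, then `J` has conformal
weight `1`. -/
theorem weight_smul_eq (h : d.IsSPVA) {G : P} {c : ℂ} (hG : d.IsSuperconformal G c)
    (hJ : J ∈ d.part 0) {Δ : ℝ} (hprim : d.IsPrimary G J Δ) (hJJ : d.lb0 J J 0 = -G) :
    (Δ : ℂ) • G = G := by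
  obtain ⟨hG1, -, hGG1, -⟩ := hG
  obtain ⟨h0, h1, -, h1', -⟩ := hprim
  have hj := h.jacobi00 1 0 G hG1 J hJ J 1 0
  have hder : d.lb0 (d.der J) J 1 = G := by
    simpa [hJJ] using h.lb0_der_left_succ J J 0
  simp [Finset.sum_range_succ, show (1 + 1 : ZMod 2) = 0 from rfl, sg_zero_left, sg1_zero, h0, h1,
    h1', hJJ, h.sesq1', hGG1, hder, -Algebra.smul_mul_assoc] at hj
  have h4 : (4 : ℂ) • ((Δ : ℂ) • G) = (4 : ℂ) • G := by
    linear_combination (norm := module) hj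
  exact smul_right_injective P (by norm_num : (4 : ℂ) ≠ 0) h4

end SPVAData.IsSPVA

/-- Induction principle for a freely generated `N=1` differential superalgebra: a subspace which
contains `1` and the generators, and whose homogeneous elements are stable under products and
the odd derivation, is everything. -/
theorem FreelyGenerates₁.eq_top {P : Type} [Ring P] [Algebra ℂ P]
    {part : ZMod 2 → Submodule ℂ P} {der sder : P →ₗ[ℂ] P} {ι : Type} {x : ι → P}
    {px : ι → ZMod 2} (hfree : FreelyGenerates₁ P part der sder x px)
    (hP : SuperDiffTargetOK P part der) (hD : OddDerOK P part der sder)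
    (hx : ∀ i, x i ∈ part (px i)) (N : Submodule ℂ P) (h_one : 1 ∈ N)
    (h_mul : ∀ i j, ∀ a ∈ part i, ∀ b ∈ part j, a ∈ N → b ∈ N → a * b ∈ N)
    (h_sder : ∀ i, ∀ a ∈ part i, a ∈ N → sder a ∈ N) (h_gen : ∀ i, x i ∈ N) : N = ⊤ := by
  obtain ⟨hc, h1, hmul, hsc, hder, hdm⟩ := hP
  obtain ⟨hsm, hsd, hss⟩ := hD
  let S₀ : Submodule ℂ P := (part 0 ⊓ N) ⊔ (part 1 ⊓ N)
  have hS : ∀ i, ∀ a ∈ part i, a ∈ N → a ∈ S₀ := by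
    intro i a ha haN
    rcases zmod2_cases i with rfl | rfl
    · exact Submodule.mem_sup_left ⟨ha, haN⟩
    · exact Submodule.mem_sup_right ⟨ha, haN⟩
  have hmulS : ∀ a b, a ∈ S₀ → b ∈ S₀ → a * b ∈ S₀ := by
    intro a b ha hb
    have key : ∀ i j, ∀ a ∈ part i ⊓ N, ∀ b ∈ part j ⊓ N, a * b ∈ S₀ := fun i j a ha b hb =>
      hS _ _ (hmul i j a ha.1 b hb.1) (h_mul i j a ha.1 b hb.1 ha.2 hb.2)
    obtain ⟨a0, ha0, a1, ha1, rfl⟩ := Submodule.mem_sup.1 ha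
    obtain ⟨b0, hb0, b1, hb1, rfl⟩ := Submodule.mem_sup.1 hb
    rw [add_mul, mul_add, mul_add]
    exact add_mem (add_mem (key _ _ _ ha0 _ hb0) (key _ _ _ ha0 _ hb1))
      (add_mem (key _ _ _ ha1 _ hb0) (key _ _ _ ha1 _ hb1))
  let S : Subalgebra ℂ P := S₀.toSubalgebra (hS 0 1 h1 h_one) hmulS
  have hsS : ∀ a : S, sder a ∈ S := by
    rintro ⟨a, ha⟩
    obtain ⟨a0, ha0, a1, ha1, rfl⟩ := Submodule.mem_sup.1 ha
    change sder (a0 + a1) ∈ S₀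
    rw [map_add]
    exact add_mem (hS _ _ (hsm _ _ ha0.1) (h_sder _ _ ha0.1 ha0.2))
      (hS _ _ (hsm _ _ ha1.1) (h_sder _ _ ha1.1 ha1.2))
  have hdS : ∀ a : S, der a ∈ S := fun a => by
    rw [← hss]
    exact hsS ⟨_, hsS a⟩
  let pS : ZMod 2 → Submodule ℂ S := fun i => (part i).comap S.val.toLinearMap
  let dS : S →ₗ[ℂ] S := (der ∘ₗ S.val.toLinearMap).codRestrict (Subalgebra.toSubmodule S) hdS
  let sS : S →ₗ[ℂ] S := (sder ∘ₗ S.val.toLinearMap).codRestrict (Subalgebra.toSubmodule S) hsS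
  have hcS : IsCompl (pS 0) (pS 1) := by
    refine ⟨?_, ?_⟩
    · rw [Submodule.disjoint_def]
      intro a ha0 ha1
      exact Subtype.ext (Submodule.disjoint_def.1 hc.disjoint a ha0 ha1)
    · rw [codisjoint_iff, eq_top_iff]
      rintro ⟨a, ha⟩ -
      obtain ⟨a0, ha0, a1, ha1, rfl⟩ := Submodule.mem_sup.1 ha
      exact Submodule.mem_sup.2 ⟨⟨a0, hS 0 a0 ha0.1 ha0.2⟩, ha0.1,
        ⟨a1, hS 1 a1 ha1.1 ha1.2⟩, ha1.1, rfl⟩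
  have hSOK : SuperDiffTargetOK S pS dS :=
    ⟨hcS, h1, fun i j a ha b hb => hmul i j a ha b hb,
      fun i j a ha b hb => Subtype.ext (hsc i j a ha b hb),
      fun i a ha => hder i a ha, fun a b => Subtype.ext (hdm a b)⟩
  have hSD : OddDerOK S pS dS sS :=
    ⟨fun i a ha => hsm i a ha, fun i a ha b => Subtype.ext (hsd i a ha b),
      fun a => Subtype.ext (hss a)⟩
  obtain ⟨φ, ⟨hφx, hφd, hφs, hφp⟩, -⟩ := hfree S pS dS sS hSOK hSD
    (fun i => ⟨x i, hS _ _ (hx i) (h_gen i)⟩) hx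
  have hid : S.val.comp φ = AlgHom.id ℂ P := by
    refine (hfree P part der sder ⟨hc, h1, hmul, hsc, hder, hdm⟩ ⟨hsm, hsd, hss⟩ x hx).unique
      ⟨fun i => ?_, fun p => ?_, fun p => ?_, fun j a ha => hφp j a ha⟩
      ⟨fun _ => rfl, fun _ => rfl, fun _ => rfl, fun _ _ ha => ha⟩
    · exact congrArg Subtype.val (hφx i)
    · exact congrArg Subtype.val (hφd p)
    · exact congrArg Subtype.val (hφs p)
  rw [eq_top_iff]
  intro p _
  have hp : (φ p : P) = p := DFunLike.congr_fun hid p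
  have hpS : p ∈ S₀ := hp ▸ (φ p).2
  exact (sup_le inf_le_right inf_le_right : S₀ ≤ N) hpS

/-- An odd member of a free generating family is nonzero. -/
theorem FreelyGenerates₁.ne_zero {P : Type} [Ring P] [Algebra ℂ P]
    {part : ZMod 2 → Submodule ℂ P} {der sder : P →ₗ[ℂ] P} {ι : Type} {x : ι → P}
    {px : ι → ZMod 2} (hfree : FreelyGenerates₁ P part der sder x px) {k : ι}
    (hk : px k = 1) : x k ≠ 0 := by
  classical
  let pA : ZMod 2 → Submodule ℂ (TrivSqZeroExt ℂ ℂ) := fun i =>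
    if i = 0 then LinearMap.ker (TrivSqZeroExt.sndHom ℂ ℂ)
    else LinearMap.ker (TrivSqZeroExt.fstHom ℂ ℂ ℂ).toLinearMap
  have m0 : ∀ a, a ∈ pA 0 ↔ a.snd = 0 := fun a => Iff.rfl
  have m1 : ∀ a, a ∈ pA 1 ↔ a.fst = 0 := fun a => Iff.rfl
  have hA : SuperDiffTargetOK (TrivSqZeroExt ℂ ℂ) pA 0 := by
    refine ⟨⟨?_, ?_⟩, ?_, ?_, ?_, ?_, ?_⟩
    · rw [Submodule.disjoint_def]
      exact fun a h0 h1 => TrivSqZeroExt.ext ((m1 a).1 h1) ((m0 a).1 h0)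
    · rw [codisjoint_iff, eq_top_iff]
      intro a _
      refine Submodule.mem_sup.2 ⟨TrivSqZeroExt.inl a.fst, ?_, TrivSqZeroExt.inr a.snd, ?_,
        TrivSqZeroExt.inl_fst_add_inr_snd_eq a⟩
      · exact (m0 _).2 (TrivSqZeroExt.snd_inl ℂ _)
      · exact (m1 _).2 (TrivSqZeroExt.fst_inr ℂ _)
    · exact (m0 _).2 TrivSqZeroExt.snd_one
    · intro i j a ha b hb
      rcases zmod2_cases i with rfl | rfl <;> rcases zmod2_cases j with rfl | rfl <;>
        simp only [m0, m1, add_zero, zero_add, show (1 + 1 : ZMod 2) = 0 from rfl] at ha hb ⊢ <;>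
        simp [ha, hb]
    · intro i j a ha b hb
      rcases zmod2_cases i with rfl | rfl
      · rw [sg_zero_left, one_smul, mul_comm]
      · rcases zmod2_cases j with rfl | rfl
        · rw [sg_one_left, sg1_zero, one_smul, mul_comm]
        · simp only [m1] at ha hb
          ext <;> simp [ha, hb]
    · exact fun i a _ => zero_mem _
    · simp
  have hD : OddDerOK (TrivSqZeroExt ℂ ℂ) pA 0 0 := ⟨fun i a _ => zero_mem _, by simp, by simp⟩
  obtain ⟨φ, ⟨hφ, -⟩, -⟩ := hfree (TrivSqZeroExt ℂ ℂ) pA 0 0 hA hD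
    (fun i => if i = k then TrivSqZeroExt.inr 1 else 0) (fun i => by
      split_ifs with hi
      · rw [hi, hk]
        exact (m1 _).2 (TrivSqZeroExt.fst_inr ℂ _)
      · exact zero_mem _)
  intro h0
  have hε := hφ k
  rw [h0, map_zero, if_pos rfl] at hε
  have := congrArg TrivSqZeroExt.snd hε
  simp at this

/-- Let `P` be an `N=1` SUSY PVA with `N=1` superconformal
vector `G` of central charge `c`.  Suppose there exist `G`-primary elements
`J` and `a_i` (`i ∈ ι`) with `J` even, `{J_Λ J} = -G - (λχ/3)c`,
`{J_Λ a_i} = J_{(0|0)} a_i`, such that `{J, G} ∪ {a_i, J_{(0|0)}a_i}` freely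
generates `P` as a `ℂ[∇] = ℂ[∂,D]`-algebra.  Then, for `D̃ := J_{(0|0)}`,
`P` is an `N=2` SUSY PVA with `N=2` superconformal vector `J`; moreover `P`
is freely generated by `{J} ∪ {a_i}` as a `ℂ[∂,D,D̃]`-algebra, with all `a_i`
`J`-primary. -/
theorem stmt_8 {P : Type} [Ring P] [Algebra ℂ P] (d : SPVAData P)
    (h : d.IsSPVA) (G : P) (c : ℂ) (hG : d.IsSuperconformal G c)
    {ι : Type} (a : ι → P) (pa : ι → ZMod 2) (ha : ∀ i, a i ∈ d.part (pa i))
    (J : P) (hJeven : J ∈ d.part 0)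
    (Δa : ι → ℝ) (haprim : ∀ i, d.IsPrimary G (a i) (Δa i))
    (ΔJ : ℝ) (hJprim : d.IsPrimary G J ΔJ)
    -- `{J_Λ J} = -G - (λχ/3)c`
    (hJJ0 : d.lb0 J J 0 = -G) (hJJ0' : ∀ n, 1 ≤ n → d.lb0 J J n = 0)
    (hJJ1 : d.lb1 J J 0 = 0) (hJJ1' : d.lb1 J J 1 = (-(c / 3)) • (1 : P))
    (hJJ1'' : ∀ n, 2 ≤ n → d.lb1 J J n = 0)
    -- `{J_Λ a_i} = J_{(0|0)} a_i`
    (hJa0 : ∀ i, ∀ n, 1 ≤ n → d.lb0 J (a i) n = 0)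
    (hJa1 : ∀ i, ∀ n, d.lb1 J (a i) n = 0)
    -- `{J, G} ∪ {a_i, J_{(0|0)}a_i : i}` freely generates `P` as a
    -- `ℂ[∂,D]`-algebra
    (hfree : FreelyGenerates₁ P d.part d.der d.sder
      (fun z : (ι ⊕ ι) ⊕ Bool => match z with
        | Sum.inl (Sum.inl i) => a i
        | Sum.inl (Sum.inr i) => d.lb0 J (a i) 0
        | Sum.inr true => J
        | Sum.inr false => G)
      (fun z => match z with
        | Sum.inl (Sum.inl i) => pa i
        | Sum.inl (Sum.inr i) => pa i + 1
        | Sum.inr true => 0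
        | Sum.inr false => 1)) :
    (d.toPVAData.inducedS2PVA d.sder (d.ad00 J)).IsS2PVA ∧
    (d.toPVAData.inducedS2PVA d.sder (d.ad00 J)).IsSuperconformal J c ∧
    FreelyGenerates₂ P d.part d.der d.sder (d.ad00 J)
      (fun z : Option ι => match z with | none => J | some i => a i)
      (fun z => match z with | none => 0 | some i => pa i) ∧
    (∀ i, ∃ Δ : ℝ,
      (d.toPVAData.inducedS2PVA d.sder (d.ad00 J)).IsPrimary J (a i) Δ) := by
  have hsq : ∀ p, d.ad00 J (d.ad00 J p) = d.der p := fun p => by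
    have h2 := h.two_smul_ad00_ad00 hJeven hJJ0 p
    rw [SPVAData.IsSPVA.lb0_eq_two_smul_der hG] at h2
    exact smul_right_injective P (two_ne_zero : (2 : ℂ) ≠ 0) h2
  have hEJ : d.ad00 J J = -G := hJJ0
  have hEDJ : d.ad00 J (d.sder J) = d.sder G := by
    rw [h.ad00_sder hJeven, hEJ, map_neg, neg_neg]
  have hG0 : G ≠ 0 := hfree.ne_zero (k := Sum.inr false) rfl
  have hΔ : (ΔJ : ℂ) = 1 := by
    have hw := h.weight_smul_eq hG hJeven hJprim hJJ0
    exact smul_left_injective ℂ hG0 (hw.trans (one_smul ℂ G).symm)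
  set e := d.toPVAData.inducedS2PVA d.sder (d.ad00 J)
  have e00 : ∀ b n, e.lb00 J b n = d.lb0 G b n := fun b n => by
    change d.lb1 (d.ad00 J (d.sder J)) b n = _
    rw [hEDJ, h.sesq1']
  have e10 : ∀ b n, e.lb10 J b n = -d.lb1 G b n := fun b n => by
    change d.lb1 (d.ad00 J J) b n = _
    rw [hEJ, map_neg, LinearMap.neg_apply, Pi.neg_apply]
  have e01 : ∀ b n, e.lb01 J b n = d.lb0 J b n := fun b n => h.sesq1' J b n
  have hprimary : ∀ {b : P} {Δ : ℝ}, d.IsPrimary G b Δ → (∀ n, 1 ≤ n → d.lb0 J b n = 0) →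
      (∀ n, d.lb1 J b n = 0) → e.IsPrimary J b Δ := by
    rintro b Δ ⟨p0, p1, p2, p3, p4⟩ hb0 hb1
    refine ⟨?_, ?_, fun n hn => ?_, ?_, fun n hn => ?_, e01 b 0, fun n hn => ?_, hb1⟩
    · rw [e00, p0]; rfl
    · rw [e00, p1]
    · rw [e00, p2 n hn]
    · rw [e10, p3]; rfl
    · rw [e10, p4 n hn, neg_zero]
    · rw [e01, hb0 n hn]
  refine ⟨?_, ?_, ?_, fun i => ⟨Δa i, hprimary (haprim i) (hJa0 i) (hJa1 i)⟩⟩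
  · exact
      { pva := h.isPVA_of_le_bnd fun a b => le_max_of_le_right (le_max_right _ _)
        sder1_mem := h.sder_mem
        sder2_mem := h.ad00_mem hJeven
        sder1_mul := h.sder_mul
        sder2_mul := h.ad00_mul hJeven
        sder1_sq := h.sder_sq
        sder2_sq := hsq
        anticomm := fun b => by
          change d.sder (d.ad00 J b) + d.ad00 J (d.sder b) = 0
          rw [h.ad00_sder hJeven, add_neg_cancel]
        sder1_lb := fun i b hb => h.sder_lb1 hb
        sder2_lb := fun i b hb => h.ad00_lb1 hJeven hb
        comp01 := fun _ _ _ => rfl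
        comp10 := fun _ _ _ => rfl
        comp00 := fun _ _ _ => rfl }
  · obtain ⟨p0, p1, p2, p3, p4⟩ := hJprim
    refine ⟨hJeven, ⟨?_, ?_, fun n hn => ?_, ?_, fun n hn => ?_, e01 J 0, fun n hn => ?_,
      hJJ1, hJJ1', hJJ1''⟩, ?_⟩
    · rw [e00, p0]; rfl
    · rw [e00, p1]
      push_cast
      rw [hΔ, mul_one]
    · rw [e00, p2 n hn]
    · rw [e10, p3]; rfl
    · rw [e10, p4 n hn, neg_zero]
    · rw [e01, hJJ0' n hn]
    · have hwt : ∀ Δ, e.s2confWtSet J Δ = d.sconfWtSet G Δ := fun Δ => by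
        ext b
        simp only [S2PVAData.s2confWtSet, SPVAData.sconfWtSet, Set.mem_ofPred_eq, e00, e10, e01]
        change (_ ∧ _ ∧ -_ = -d.sder b ∧ d.lb0 J b 0 = d.lb0 J b 0) ↔ _
        rw [neg_inj]
        tauto
      simp only [hwt]
      exact hG.2.2.2.2.2.2.2.2
  · have hgen : ∀ z : (ι ⊕ ι) ⊕ Bool, (match z with
        | Sum.inl (Sum.inl i) => a i
        | Sum.inl (Sum.inr i) => d.lb0 J (a i) 0
        | Sum.inr true => J
        | Sum.inr false => G) ∈ d.part (match z with
        | Sum.inl (Sum.inl i) => pa i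
        | Sum.inl (Sum.inr i) => pa i + 1
        | Sum.inr true => 0
        | Sum.inr false => 1) := by
      rintro ((i | i) | (_ | _))
      · exact ha i
      · exact h.ad00_mem hJeven _ _ (ha i)
      · exact hG.1
      · exact hJeven
    intro A _ _ pA dA sA tA hA hs ht hst y hy
    obtain ⟨φ, ⟨φx, φd, φs, φp⟩, φu⟩ := hfree A pA dA sA hA hs
      (fun z => match z with
        | Sum.inl (Sum.inl i) => y (some i)
        | Sum.inl (Sum.inr i) => tA (y (some i))
        | Sum.inr true => y none
        | Sum.inr false => -tA (y none))
      (by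
        rintro ((i | i) | (_ | _))
        · exact hy (some i)
        · exact ht.1 _ _ (hy (some i))
        · exact neg_mem (ht.1 _ _ (hy none))
        · exact hy none)
    have φa : ∀ i, φ (a i) = y (some i) := fun i => φx (Sum.inl (Sum.inl i))
    have φEa : ∀ i, φ (d.ad00 J (a i)) = tA (y (some i)) := fun i => φx (Sum.inl (Sum.inr i))
    have φJ : φ J = y none := φx (Sum.inr true)
    have φG : φ G = -tA (y none) := φx (Sum.inr false)
    have φt : ∀ p, φ (d.ad00 J p) = tA (φ p) := by
      let N : Submodule ℂ P :=
        LinearMap.eqLocus (φ.toLinearMap ∘ₗ d.ad00 J) (tA ∘ₗ φ.toLinearMap)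
      have hN : ∀ p, p ∈ N ↔ φ (d.ad00 J p) = tA (φ p) := fun p => Iff.rfl
      have hNtop : N = ⊤ := by
        refine hfree.eq_top h.superDiffTargetOK h.oddDerOK hgen N ?_ ?_ ?_ ?_
        · have hE1 : d.ad00 J 1 = 0 := by
            have h1 := h.ad00_mul hJeven 0 1 h.one_mem 1
            simpa [sg1_zero] using h1
          have ht1 : tA 1 = 0 := by
            have h1 := ht.2.1 0 1 hA.2.1 1
            simpa [sg1_zero] using h1
          rw [hN, hE1, map_zero, map_one, ht1]
        · intro i j p hp q hq hpN hqN
          rw [hN] at hpN hqN ⊢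
          rw [h.ad00_mul hJeven i p hp, map_mul, ht.2.1 i _ (φp i p hp), map_add, map_smul,
            map_mul, map_mul, hpN, hqN]
        · intro i p hp hpN
          rw [hN] at hpN ⊢
          rw [h.ad00_sder hJeven, map_neg, φs, φs, hpN]
          exact neg_eq_of_add_eq_zero_right (hst _)
        · rintro ((i | i) | (_ | _))
          · exact (φEa i).trans (congrArg tA (φa i)).symm
          · change φ (d.ad00 J (d.ad00 J (a i))) = tA (φ (d.ad00 J (a i)))
            rw [hsq, φd, φa, φEa, ht.2.2]
          · change φ (d.ad00 J G) = tA (φ G)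
            rw [φG, ← neg_neg G, ← hEJ, map_neg, hsq, map_neg, φd, φJ, map_neg, ht.2.2]
          · change φ (d.ad00 J J) = tA (φ J)
            rw [hEJ, map_neg, φG, φJ, neg_neg]
      exact fun p => (hN p).1 (hNtop ▸ Submodule.mem_top)
    refine ⟨φ, ⟨?_, φd, φs, φt, φp⟩, ?_⟩
    · rintro (_ | i)
      · exact φJ
      · exact φa i
    · rintro ψ ⟨ψx, ψd, ψs, ψt, ψp⟩
      have ψJ : ψ J = y none := ψx none
      have ψa : ∀ i, ψ (a i) = y (some i) := fun i => ψx (some i)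
      refine φu ψ ⟨?_, ψd, ψs, ψp⟩
      rintro ((i | i) | (_ | _))
      · exact ψa i
      · exact (ψt (a i)).trans (congrArg tA (ψa i))
      · change ψ G = -tA (y none)
        rw [← ψJ, ← ψt, hEJ, map_neg, neg_neg]
      · exact ψJ
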